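/- arXiv:2104.05065 — 5 statements merged into one kernel-verified Lean document; each statement's English description precedes it below -/
import Mathlib

section
/- Let (R, Γ) be a maximal instance of CSP, where R = (V, r_1, ..., r_s) and Γ = (D, ρ_1, ..., ρ_s) are relational structures over a common signature. Then for every Horn rule Ψ over the signature, if Γ satisfies Ψ, then R satisfies Ψ. -/
/-- A Horn rule over the signature with `s` relation symbols of arities `arity i`:
`n` variables, a head symbol `u` (whose atom uses the first `arity u` variables),
and `N` body atoms, the `t`-th with symbol `j t` and scope `o t`. -/
structure HornRule (s : ℕ) (arity : Fin s → ℕ) where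
  n : ℕ
  u : Fin s
  head_le : arity u ≤ n
  N : ℕ
  j : Fin N → Fin s
  o : ∀ t : Fin N, Fin (arity (j t)) → Fin n

/-- A structure `(W, t)` satisfies the Horn rule `Ψ`. -/
def SatisfiesHorn {s : ℕ} {arity : Fin s → ℕ} {W : Type*}
    (t : ∀ i : Fin s, Set (Fin (arity i) → W)) (Ψ : HornRule s arity) : Prop :=
  ∀ a : Fin Ψ.n → W,
    (∀ k : Fin Ψ.N, (fun q => a (Ψ.o k q)) ∈ t (Ψ.j k)) →
    (fun q : Fin (arity Ψ.u) => a (Fin.castLE Ψ.head_le q)) ∈ t Ψ.u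

/-- The set of homomorphisms from the relational structure `(V, r)` to `(D, ρ)`. -/
def Hom {s : ℕ} {arity : Fin s → ℕ} {V D : Type*}
    (r : ∀ i : Fin s, Set (Fin (arity i) → V))
    (ρ : ∀ i : Fin s, Set (Fin (arity i) → D)) : Set (V → D) :=
  {h | ∀ i : Fin s, ∀ t ∈ r i, (fun k => h (t k)) ∈ ρ i}

/-- The instance `((V, r), (D, ρ))` is maximal. -/
def IsMaximal {s : ℕ} {arity : Fin s → ℕ} {V D : Type*}
    (r : ∀ i : Fin s, Set (Fin (arity i) → V))
    (ρ : ∀ i : Fin s, Set (Fin (arity i) → D)) : Prop :=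
  ∀ r' : ∀ i : Fin s, Set (Fin (arity i) → V),
    (∀ i, r i ⊆ r' i) → Hom r' ρ = Hom r ρ → r' = r

/-- In a maximal instance, every tuple mapped into `ρ i` by all homomorphisms lies in `r i`. -/
theorem IsMaximal.mem_of_forall_hom {s : ℕ} {arity : Fin s → ℕ} {V D : Type*}
    {r : ∀ i : Fin s, Set (Fin (arity i) → V)}
    {ρ : ∀ i : Fin s, Set (Fin (arity i) → D)}
    (hmax : IsMaximal r ρ) {i : Fin s} {t : Fin (arity i) → V}
    (ht : ∀ h ∈ Hom r ρ, (fun k => h (t k)) ∈ ρ i) : t ∈ r i := by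
  let closure : ∀ i : Fin s, Set (Fin (arity i) → V) :=
    fun i => {t | ∀ h ∈ Hom r ρ, (fun k => h (t k)) ∈ ρ i}
  have hsub : ∀ i, r i ⊆ closure i := fun i t ht h hh => hh i t ht
  have heq : closure = r := hmax closure hsub <| Set.Subset.antisymm
    (fun h hh i t ht => hh i t (hsub i ht)) (fun h hh i t ht => ht h hh)
  rw [← heq]
  exact ht

/-- If `((V,r),(D,ρ))` is a maximal instance, then every Horn rule satisfied by the
template `(D,ρ)` is satisfied by `(V,r)`. -/
theorem stmt3 {s : ℕ} {arity : Fin s → ℕ} {V D : Type*}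
    (r : ∀ i : Fin s, Set (Fin (arity i) → V))
    (ρ : ∀ i : Fin s, Set (Fin (arity i) → D))
    (hmax : IsMaximal r ρ) (Ψ : HornRule s arity)
    (hΓ : SatisfiesHorn ρ Ψ) : SatisfiesHorn r Ψ := by
  intro a ha
  exact hmax.mem_of_forall_hom fun h hh => hΓ (fun x => h (a x)) fun k => hh _ _ (ha k)
end

section
/- Let R = (V, Z, O, r) be an instance over the Horn template Γ = ({0,1}, {(0)}, {(1)}, ϱ_{x∧y→z}), and let R' = (V, Z', O', r') be the densification of (R, Γ), i.e. the unique maximal instance with Z' ⊇ Z, O' ⊇ O, r' ⊇ r and Hom(R', Γ) = Hom(R, Γ). If Hom(R, Γ) ≠ ∅, then O' = o_Σ(O). -/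
/-- Homomorphisms from the instance `(V, Z, O, r)` to the Horn template
`({0,1}, {(0)}, {(1)}, ϱ_{x∧y→z})`. -/
def HornHom {V : Type*} (Z O : Set V) (r : Set (V × V × V)) : Set (V → Bool) :=
  {h | (∀ v ∈ Z, h v = false) ∧ (∀ v ∈ O, h v = true) ∧
       ∀ c ∈ r, (h c.1 && h c.2.1) ≤ h c.2.2}

/-- The closure `o_Σ(S)`: the smallest `T ⊇ S` such that `(i,j,k) ∈ r` and `i, j ∈ T`
imply `k ∈ T`. -/
def hornClosure {V : Type*} (r : Set (V × V × V)) (S : Set V) : Set V :=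
  ⋂₀ {T : Set V | S ⊆ T ∧ ∀ i j k : V, (i, j, k) ∈ r → i ∈ T → j ∈ T → k ∈ T}

theorem subset_hornClosure {V : Type*} (r : Set (V × V × V)) (S : Set V) :
    S ⊆ hornClosure r S :=
  Set.subset_sInter fun _ hT => hT.1

theorem hornClosure_closed {V : Type*} {r : Set (V × V × V)} {S : Set V} {i j k : V}
    (hijk : (i, j, k) ∈ r) (hi : i ∈ hornClosure r S) (hj : j ∈ hornClosure r S) :
    k ∈ hornClosure r S :=
  fun T hT => hT.2 i j k hijk (hi T hT) (hj T hT)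

/-- Every homomorphism is constantly `1` on the closure of `O`. -/
theorem HornHom.eq_true_of_mem_hornClosure {V : Type*} {Z O : Set V} {r : Set (V × V × V)}
    {h : V → Bool} (hh : h ∈ HornHom Z O r) {v : V} (hv : v ∈ hornClosure r O) :
    h v = true := by
  refine hv {v | h v = true} ⟨hh.2.1, fun i j k hijk hi hj => ?_⟩
  exact Bool.le_iff_imp.mp (hh.2.2 _ hijk) (Bool.and_eq_true_iff.mpr ⟨hi, hj⟩)

open Classical in
/-- If there is a homomorphism at all, the indicator function of the closure of `O` is one. -/
theorem HornHom.indicator_hornClosure_mem {V : Type*} {Z O : Set V} {r : Set (V × V × V)}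
    (hne : (HornHom Z O r).Nonempty) :
    (fun v => decide (v ∈ hornClosure r O)) ∈ HornHom Z O r := by
  obtain ⟨g, hg⟩ := hne
  refine ⟨fun v hv => ?_, fun v hv => ?_, fun ⟨i, j, k⟩ hijk => ?_⟩
  · refine decide_eq_false fun hmem => ?_
    simpa [hg.1 v hv] using HornHom.eq_true_of_mem_hornClosure hg hmem
  · exact decide_eq_true (subset_hornClosure r O hv)
  · rw [Bool.le_iff_imp]
    simpa using fun hi hj => hornClosure_closed hijk hi hj

/-- If `(V, Z', O', r')` is the densification of `(V, Z, O, r)` over the Horn template and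
there is at least one homomorphism, then `O' = o_Σ(O)`. -/
theorem stmt9 {V : Type*} (Z O : Set V) (r : Set (V × V × V))
    (Z' O' : Set V) (r' : Set (V × V × V))
    (hZ : Z ⊆ Z') (hO : O ⊆ O') (hr : r ⊆ r')
    (hHom : HornHom Z' O' r' = HornHom Z O r)
    (hMax : ∀ (Z'' O'' : Set V) (r'' : Set (V × V × V)),
      Z' ⊆ Z'' → O' ⊆ O'' → r' ⊆ r'' →
      HornHom Z'' O'' r'' = HornHom Z' O' r' → Z'' = Z' ∧ O'' = O' ∧ r'' = r')
    (hne : (HornHom Z O r).Nonempty) :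
    O' = hornClosure r O := by
  classical
  apply Set.Subset.antisymm
  · intro v hv
    have hmem := HornHom.indicator_hornClosure_mem hne
    rw [← hHom] at hmem
    exact of_decide_eq_true (hmem.2.1 v hv)
  · have hsame : HornHom Z' (O' ∪ hornClosure r O) r' = HornHom Z' O' r' := by
      ext h
      refine ⟨fun hh => ⟨hh.1, fun v hv => hh.2.1 v (Or.inl hv), hh.2.2⟩, fun hh => ?_⟩
      refine ⟨hh.1, fun v hv => hv.elim (hh.2.1 v) fun hv => ?_, hh.2.2⟩
      exact HornHom.eq_true_of_mem_hornClosure (hHom ▸ hh) hv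
    have hO' := (hMax Z' (O' ∪ hornClosure r O) r' subset_rfl Set.subset_union_left
      subset_rfl hsame).2.1
    exact Set.union_eq_left.mp hO'
end

section
/- Every relation ρ ⊆ {0,1}^n that is closed under componentwise conjunction is A-reducible to the Horn template Γ_Horn, i.e. ρ is a finite intersection of n-ary relations each of which is strongly reducible to Γ_Horn. -/
/-- A relation on `{0,1}^m` is closed under componentwise conjunction. -/
def ConjClosed {m : ℕ} (σ : Set (Fin m → Bool)) : Prop :=
  ∀ x ∈ σ, ∀ y ∈ σ, (fun i => x i && y i) ∈ σ

/-- Projection of a relation on `{0,1}^m` to the first `k` coordinates. -/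
def projFirst {m k : ℕ} (h : k ≤ m) (σ : Set (Fin m → Bool)) : Set (Fin k → Bool) :=
  {y | ∃ x ∈ σ, ∀ i : Fin k, x (Fin.castLE h i) = y i}

/-- The solution set of a constraint family over the Horn template
`Γ_Horn = ({0,1}, {(0)}, {(1)}, {(x,y,z) : x·y ≤ z})` on `m` variables, where `A` is the
finite set of scopes of `{(0)}`-constraints, `B` of `{(1)}`-constraints and `C` of
ternary `x·y ≤ z` constraints. -/
def HornSol {m : ℕ} (A B : Finset (Fin m)) (C : Finset (Fin m × Fin m × Fin m)) :
    Set (Fin m → Bool) :=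
  {x | (∀ i ∈ A, x i = false) ∧ (∀ i ∈ B, x i = true) ∧
       ∀ c ∈ C, (x c.1 && x c.2.1) ≤ x c.2.2}

/-- `σ ⊆ {0,1}^k` is strongly reducible to the Horn template. -/
def StronglyReducibleHorn {k : ℕ} (σ : Set (Fin k → Bool)) : Prop :=
  ∃ (m : ℕ) (h : k ≤ m) (A B : Finset (Fin m)) (C : Finset (Fin m × Fin m × Fin m))
    (δ : Set (Fin m → Bool)),
    projFirst h (HornSol A B C) = σ ∧ projFirst h δ = σᶜ ∧
    ConjClosed (HornSol A B C ∪ δ)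

/-- `ρ ⊆ {0,1}^k` is A-reducible to the Horn template: a finite intersection of
relations strongly reducible to it. -/
def AReducibleHorn {k : ℕ} (ρ : Set (Fin k → Bool)) : Prop :=
  ∃ (l : ℕ) (ρs : Fin l → Set (Fin k → Bool)),
    (∀ i, StronglyReducibleHorn (ρs i)) ∧ ρ = ⋂ i, ρs i

/-- Extend a point by the conjunctions of its coordinates in `S` over all initial segments. -/
def segmentConj {n : ℕ} (S : Finset (Fin n)) (x : Fin n → Bool) : Fin (n + (n + 1)) → Bool :=
  Fin.append x fun t => decide (∀ i ∈ S, i.val < t.val → x i = true)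

@[simp]
theorem segmentConj_castAdd {n : ℕ} (S : Finset (Fin n)) (x : Fin n → Bool) (i : Fin n) :
    segmentConj S x (Fin.castAdd (n + 1) i) = x i := by
  simp [segmentConj]

@[simp]
theorem segmentConj_natAdd {n : ℕ} (S : Finset (Fin n)) (x : Fin n → Bool) (t : Fin (n + 1)) :
    segmentConj S x (Fin.natAdd n t) = decide (∀ i ∈ S, i.val < t.val → x i = true) := by
  simp [segmentConj]

theorem segmentConj_and {n : ℕ} (S : Finset (Fin n)) (x y : Fin n → Bool) :
    segmentConj S (fun i => x i && y i) = fun i => segmentConj S x i && segmentConj S y i := by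
  funext i
  refine Fin.addCases (fun i => ?_) (fun t => ?_) i
  · simp
  · simp only [segmentConj_natAdd, Bool.and_eq_true, ← Bool.decide_and, decide_eq_decide]
    grind

/-- The image of `segmentConj` is defined by the Horn constraints valid on it. -/
theorem exists_hornSol_eq_range_segmentConj {n : ℕ} (S : Finset (Fin n)) :
    ∃ (B : Finset (Fin (n + (n + 1))))
      (C : Finset (Fin (n + (n + 1)) × Fin (n + (n + 1)) × Fin (n + (n + 1)))),
      HornSol ∅ B C = Set.range (segmentConj S) := by
  classical
  refine ⟨Finset.univ.filter fun i => ∀ x, segmentConj S x i = true,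
    Finset.univ.filter fun c =>
      ∀ x, (segmentConj S x c.1 && segmentConj S x c.2.1) ≤ segmentConj S x c.2.2, ?_⟩
  ext z
  constructor
  · rintro ⟨-, hB, hC⟩
    simp only [Finset.mem_filter, Finset.mem_univ, true_and] at hB hC
    have valid (i j k : Fin (n + (n + 1)))
        (hv : ∀ x, segmentConj S x i = true → segmentConj S x j = true → segmentConj S x k = true)
        (hi : z i = true) (hj : z j = true) : z k = true := by
      have := hC (i, j, k) (fun x => by have := hv x; revert this; simp [Bool.le_iff_imp])
      simpa [hi, hj, Bool.le_iff_imp] using this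
    refine ⟨fun i => z (Fin.castAdd (n + 1) i), ?_⟩
    funext i
    refine Fin.addCases (fun i => by simp) (fun t => ?_) i
    induction t using Fin.induction with
    | zero => rw [hB _ (by simp)]; simp
    | succ t ih =>
      rw [segmentConj_natAdd] at ih ⊢
      have down : z (Fin.natAdd n t.succ) = true → z (Fin.natAdd n t.castSucc) = true :=
        fun h => valid _ _ _ (by simp; grind) h h
      by_cases ht : t ∈ S
      · have coord : z (Fin.natAdd n t.succ) = true → z (Fin.castAdd (n + 1) t) = true :=
          fun h => valid _ _ _ (by simp; grind) h h
        have up : z (Fin.natAdd n t.castSucc) = true → z (Fin.castAdd (n + 1) t) = true →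
            z (Fin.natAdd n t.succ) = true :=
          valid _ _ _ (by simp; grind)
        rw [Bool.eq_iff_iff, decide_eq_true_iff] at ih ⊢
        simp only [Fin.val_castSucc, Fin.val_succ] at ih ⊢
        grind
      · have up : z (Fin.natAdd n t.castSucc) = true → z (Fin.natAdd n t.succ) = true :=
          fun h => valid _ _ _ (by simp; grind) h h
        rw [Bool.eq_iff_iff, decide_eq_true_iff] at ih ⊢
        simp only [Fin.val_castSucc, Fin.val_succ] at ih ⊢
        grind
  · rintro ⟨x, rfl⟩
    refine ⟨by simp, fun i hi => ?_, fun c hc => ?_⟩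
    · exact (Finset.mem_filter.1 hi).2 x
    · exact (Finset.mem_filter.1 hc).2 x

/-- Horn constraints on the initial-segment conjunctions define strongly reducible relations. -/
theorem stronglyReducibleHorn_segmentConj_preimage {n : ℕ} (S : Finset (Fin n))
    (A : Finset (Fin (n + (n + 1))))
    (C : Finset (Fin (n + (n + 1)) × Fin (n + (n + 1)) × Fin (n + (n + 1)))) :
    StronglyReducibleHorn (segmentConj S ⁻¹' HornSol A ∅ C) := by
  classical
  obtain ⟨B, C₀, hrange⟩ := exists_hornSol_eq_range_segmentConj S
  have proj (σ : Set (Fin n → Bool)) :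
      projFirst (Nat.le_add_right n (n + 1)) (segmentConj S '' σ) = σ := by
    ext y
    constructor
    · rintro ⟨_, ⟨x, hx, rfl⟩, hxy⟩
      have : x = y := funext fun i => (segmentConj_castAdd S x i).symm.trans (hxy i)
      exact this ▸ hx
    · exact fun hy => ⟨_, ⟨y, hy, rfl⟩, fun i => segmentConj_castAdd S y i⟩
  have sol : HornSol A B (C₀ ∪ C) = segmentConj S '' (segmentConj S ⁻¹' HornSol A ∅ C) := by
    rw [Set.image_preimage_eq_inter_range, ← hrange]
    ext z
    simp only [HornSol, Set.mem_inter_iff, Set.mem_ofPred_eq, Finset.mem_union,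
      Finset.notMem_empty]
    grind
  refine ⟨_, Nat.le_add_right n (n + 1), A, B, C₀ ∪ C,
    segmentConj S '' (segmentConj S ⁻¹' HornSol A ∅ C)ᶜ, ?_, proj _, ?_⟩
  · rw [sol, proj]
  · rw [sol, ← Set.image_union, Set.union_compl_self]
    rintro _ ⟨x, -, rfl⟩ _ ⟨y, -, rfl⟩
    exact ⟨_, trivial, segmentConj_and S x y⟩

theorem stronglyReducibleHorn_implication {n : ℕ} (S : Finset (Fin n)) (j : Fin n) :
    StronglyReducibleHorn {x : Fin n → Bool | (∀ i ∈ S, x i = true) → x j = true} := by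
  convert stronglyReducibleHorn_segmentConj_preimage S ∅
    {(Fin.natAdd n (Fin.last n), Fin.natAdd n (Fin.last n), Fin.castAdd (n + 1) j)} using 1
  ext x
  simp [HornSol, Bool.le_iff_imp, -Fin.natAdd_last]

theorem stronglyReducibleHorn_negative {n : ℕ} (S : Finset (Fin n)) :
    StronglyReducibleHorn {x : Fin n → Bool | ¬ ∀ i ∈ S, x i = true} := by
  convert stronglyReducibleHorn_segmentConj_preimage S {Fin.natAdd n (Fin.last n)} ∅ using 1
  ext x
  simp [HornSol, -Fin.natAdd_last]

/-- If every coordinate vanishing at `a` vanishes at some point of `ρ` above `a`, and `ρ` has a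
point above `a`, then `a ∈ ρ`. -/
theorem ConjClosed.mem_of_forall_exists {n : ℕ} {ρ : Set (Fin n → Bool)} (h : ConjClosed ρ)
    {a : Fin n → Bool} (hne : ∃ x ∈ ρ, ∀ i, a i = true → x i = true)
    (hsep : ∀ j, a j = false → ∃ x ∈ ρ, (∀ i, a i = true → x i = true) ∧ x j = false) :
    a ∈ ρ := by
  classical
  have key (T : Finset (Fin n)) : ∃ x ∈ ρ, (∀ i, a i = true → x i = true) ∧
      ∀ j ∈ T, a j = false → x j = false := by
    induction T using Finset.induction with
    | empty => simpa using hne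
    | insert j T _ ih =>
      obtain ⟨x, hx, hax, hxT⟩ := ih
      cases hj : a j with
      | true => exact ⟨x, hx, hax, by grind⟩
      | false =>
        obtain ⟨y, hy, hay, hyj⟩ := hsep j hj
        exact ⟨_, h x hx y hy, by grind, by grind⟩
  obtain ⟨x, hx, hax, hxa⟩ := key Finset.univ
  have : x = a := by
    funext i
    cases hi : a i with
    | true => exact hax i hi
    | false => exact hxa i (Finset.mem_univ i) hi
  exact this ▸ hx

theorem ConjClosed.exists_stronglyReducibleHorn_separating {n : ℕ} {ρ : Set (Fin n → Bool)}
    (h : ConjClosed ρ) {a : Fin n → Bool} (ha : a ∉ ρ) :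
    ∃ σ, StronglyReducibleHorn σ ∧ ρ ⊆ σ ∧ a ∉ σ := by
  by_cases hne : ∃ x ∈ ρ, ∀ i, a i = true → x i = true
  · by_cases hsep : ∀ j, a j = false →
        ∃ x ∈ ρ, (∀ i, a i = true → x i = true) ∧ x j = false
    · exact absurd (h.mem_of_forall_exists hne hsep) ha
    · push Not at hsep
      obtain ⟨j, hj, hρ⟩ := hsep
      refine ⟨_, stronglyReducibleHorn_implication {i | a i = true} j, fun x hx hax => ?_, ?_⟩
      · exact Bool.eq_true_of_not_eq_false (hρ x hx (by simpa using hax))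
      · simp [hj]
  · refine ⟨_, stronglyReducibleHorn_negative {i | a i = true}, fun x hx hax => ?_, ?_⟩
    · exact hne ⟨x, hx, by simpa using hax⟩
    · simp

/-- Every ∧-closed relation on `{0,1}^n` is A-reducible to the Horn template. -/
theorem stmt12 (n : ℕ) (ρ : Set (Fin n → Bool)) (h : ConjClosed ρ) :
    AReducibleHorn ρ := by
  classical
  choose σ hσ hρσ haσ using fun a : {a // a ∉ ρ} =>
    h.exists_stronglyReducibleHorn_separating a.2
  let e := Fintype.equivFin {a // a ∉ ρ}
  refine ⟨_, fun i => σ (e.symm i), fun i => hσ _, ?_⟩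
  refine Set.Subset.antisymm (Set.subset_iInter fun i => hρσ _) fun a ha => ?_
  by_contra hna
  have := Set.mem_iInter.1 ha (e ⟨a, hna⟩)
  rw [e.symm_apply_apply] at this
  exact haσ _ this
end

section
/- Let n ≥ 2 and let ρ = {x ∈ {0,1}^n : ¬(x_1 ∧ ⋯ ∧ x_n)}. Define Ξ ⊆ {0,1}^{2n-1} as the set of all x satisfying: x_1 ∧ x_2 ≤ x_{n+1}; x_i ∧ x_{n+i-2} ≤ x_{n+i-1} for all 3 ≤ i ≤ n; and x_{2n-1} = 0. Let δ = {(1, 1, ..., 1)} ⊆ {0,1}^{2n-1}. Then: (i) Ξ ∪ δ is closed under componentwise conjunction; (ii) the projection of Ξ to the first n coordinates equals ρ; (iii) the projection of δ to the first n coordinates equals {0,1}^n \ ρ. -/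
/-- Gadget for the negative Horn clause `¬(x₁ ∧ ⋯ ∧ xₙ)` (here with 1-based indices of
the paper translated to 0-based indices): `Ξ ∪ δ` is ∧-closed, `Ξ` projects onto
`ρ = {x : ¬(x₁ ∧ ⋯ ∧ xₙ)}`, and `δ = {(1,…,1)}` projects onto its complement. -/
theorem stmt14 (n : ℕ) (hn : 2 ≤ n)
    (Xi : Set (Fin (2 * n - 1) → Bool))
    (hXi : Xi = {x | ((x ⟨0, by omega⟩ && x ⟨1, by omega⟩) ≤ x ⟨n, by omega⟩) ∧
        (∀ i : ℕ, ∀ _h3 : 3 ≤ i, ∀ _hn : i ≤ n,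
          (x ⟨i - 1, by omega⟩ && x ⟨n + i - 3, by omega⟩) ≤ x ⟨n + i - 2, by omega⟩) ∧
        x ⟨2 * n - 2, by omega⟩ = false})
    (δ : Set (Fin (2 * n - 1) → Bool)) (hδ : δ = {fun _ => true}) :
    ConjClosed (Xi ∪ δ) ∧
    projFirst (by omega : n ≤ 2 * n - 1) Xi = {x : Fin n → Bool | ¬ ∀ i, x i = true} ∧
    projFirst (by omega : n ≤ 2 * n - 1) δ = {x : Fin n → Bool | ¬ ∀ i, x i = true}ᶜ := by
  subst hXi hδ
  simp only [Bool.le_iff_imp, Bool.and_eq_true]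
  refine ⟨?_, ?_, ?_⟩
  · rintro x (⟨hx0, hx, hxl⟩ | rfl) y (⟨hy0, hy, hyl⟩ | rfl)
    · refine Or.inl ⟨?_, fun i h3 hi => ?_, by simp [hxl]⟩
      · simp only [Bool.and_eq_true]
        exact fun h => ⟨hx0 ⟨h.1.1, h.2.1⟩, hy0 ⟨h.1.2, h.2.2⟩⟩
      · simp only [Bool.and_eq_true]
        exact fun h => ⟨hx i h3 hi ⟨h.1.1, h.2.1⟩, hy i h3 hi ⟨h.1.2, h.2.2⟩⟩
    · simp only [Bool.and_true]
      exact Or.inl ⟨hx0, hx, hxl⟩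
    · simp only [Bool.true_and]
      exact Or.inl ⟨hy0, hy, hyl⟩
    · exact Or.inr rfl
  · ext y
    constructor
    · rintro ⟨x, ⟨h0, hstep, hlast⟩, hxy⟩ hy
      have hfirst (k : ℕ) (hk : k < n) : x ⟨k, by omega⟩ = true :=
        (hxy ⟨k, hk⟩).trans (hy _)
      have haux (j : ℕ) (hj : j + 2 ≤ n) : x ⟨n + j, by omega⟩ = true := by
        induction j with
        | zero => exact h0 ⟨hfirst 0 (by omega), hfirst 1 (by omega)⟩
        | succ j ih =>
          exact hstep (j + 3) (by omega) hj ⟨hfirst (j + 2) (by omega), ih (by omega)⟩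
      have hend := haux (n - 2) (by omega)
      simp only [show n + (n - 2) = 2 * n - 2 by omega, hlast] at hend
      exact Bool.false_ne_true hend
    · intro hy
      -- The coordinate `n + j` holds the conjunction of the coordinates `0, …, j + 1`.
      refine ⟨fun k => if h : k.1 < n then y ⟨k, h⟩
        else decide (∀ i : Fin n, i.1 ≤ k.1 - n + 1 → y i = true), ⟨?_, ?_, ?_⟩, ?_⟩
      · beta_reduce
        rw [dif_pos (show 0 < n by omega), dif_pos (show 1 < n by omega),
          dif_neg (lt_irrefl n), decide_eq_true_iff]
        rintro ⟨h0, h1⟩ ⟨i, hin⟩ hi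
        obtain rfl | rfl : i = 0 ∨ i = 1 := by simp at hi; omega
        exacts [h0, h1]
      · intro i h3 hi
        beta_reduce
        rw [dif_pos (show i - 1 < n by omega), dif_neg (show ¬ n + i - 3 < n by omega),
          dif_neg (show ¬ n + i - 2 < n by omega), decide_eq_true_iff, decide_eq_true_iff]
        rintro ⟨hlast, hprev⟩ ⟨k, hkn⟩ hk
        obtain rfl | hne := eq_or_ne k (i - 1)
        · exact hlast
        · exact hprev _ (by dsimp only at hk ⊢; omega)
      · beta_reduce
        rw [dif_neg (show ¬ 2 * n - 2 < n by omega), decide_eq_false_iff_not]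
        exact fun h => hy fun i => h i (by dsimp only; omega)
      · exact fun i => dif_pos i.2
  · ext y
    simp only [Set.mem_compl_iff, Set.mem_ofPred_eq, not_not]
    constructor
    · rintro ⟨x, rfl, hxy⟩ i
      exact (hxy i).symm
    · exact fun hy => ⟨fun _ => true, rfl, fun i => (hy i).symm⟩
end

section
/- Let n ≥ 3 and let ρ = {x ∈ {0,1}^{n+1} : x_1 ∧ ⋯ ∧ x_n ≤ x_{n+1}}. Define Ξ ⊆ {0,1}^{2n} as the set of all x satisfying: x_{2n} = 1; x_1 ∧ x_2 = x_{n+2}; x_i ∧ x_{n+i-1} = x_{n+i} for all 3 ≤ i ≤ n-1; and x_n ∧ x_{2n-1} ≤ x_{n+1}. Let δ ⊆ {0,1}^{2n} be the single tuple with entry 0 in coordinate n+1 and entry 1 in all other coordinates. Then: (i) Ξ ∪ δ is closed under componentwise conjunction; (ii) the projection of Ξ to the first n+1 coordinates equals ρ; (iii) the projection of δ to the first n+1 coordinates equals {0,1}^{n+1} \ ρ. -/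
/-- A tuple satisfying the chain of conjunctions whose last link and last conjunct are `1`
has entry `1` in every coordinate other than the head of the clause. -/
theorem chain_eq_true {n : ℕ} (hn : 3 ≤ n) (x : Fin (2 * n) → Bool)
    (htop : ∀ h, x ⟨2 * n - 1, h⟩ = true)
    (hbase : ∀ h₀ h₁ h, (x ⟨0, h₀⟩ && x ⟨1, h₁⟩) = x ⟨n + 1, h⟩)
    (hstep : ∀ i : ℕ, 3 ≤ i → i ≤ n - 1 → ∀ h₀ h₁ h,
      (x ⟨i - 1, h₀⟩ && x ⟨n + i - 2, h₁⟩) = x ⟨n + i - 1, h⟩)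
    (hlast : ∀ h, x ⟨n - 1, h⟩ = true) (hlink : ∀ h, x ⟨2 * n - 2, h⟩ = true)
    (j : Fin (2 * n)) (hj : (j : ℕ) ≠ n) : x j = true := by
  have links : ∀ k : ℕ, ∀ hk : k ≤ n - 3, x ⟨2 * n - 2 - k, by omega⟩ = true := by
    intro k
    induction k with
    | zero => intro _; exact hlink _
    | succ k ih =>
      intro hk
      have h := hstep (n - 1 - k) (by omega) (by omega)
        (by omega) (by omega) (by omega)
      have e : (⟨n + (n - 1 - k) - 1, by omega⟩ : Fin (2 * n)) = ⟨2 * n - 2 - k, by omega⟩ :=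
        Fin.ext (by simp only; omega)
      have e' : (⟨n + (n - 1 - k) - 2, by omega⟩ : Fin (2 * n))
          = ⟨2 * n - 2 - (k + 1), by omega⟩ := Fin.ext (by simp only; omega)
      rw [e, e', ih (by omega), Bool.and_eq_true] at h
      exact h.2
  have links' : ∀ m : ℕ, ∀ _ : n + 1 ≤ m, ∀ _ : m ≤ 2 * n - 2, x ⟨m, by omega⟩ = true := by
    intro m h₁ h₂
    have h := links (2 * n - 2 - m) (by omega)
    have e : (⟨2 * n - 2 - (2 * n - 2 - m), by omega⟩ : Fin (2 * n)) = ⟨m, by omega⟩ :=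
      Fin.ext (by simp only; omega)
    rwa [e] at h
  have hfirst := hbase (by omega) (by omega) (by omega)
  rw [links' (n + 1) (by omega) (by omega), Bool.and_eq_true] at hfirst
  obtain ⟨j, hj'⟩ := j
  simp only at hj
  rcases lt_or_gt_of_ne hj with hlt | hgt
  · by_cases h0 : j = 0
    · subst h0; exact hfirst.1
    by_cases h1 : j = 1
    · subst h1; exact hfirst.2
    by_cases hl : j = n - 1
    · subst hl; exact hlast _
    have h := hstep (j + 1) (by omega) (by omega) (by omega) (by omega) (by omega)
    rw [links' (n + (j + 1) - 1) (by omega) (by omega), Bool.and_eq_true] at h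
    exact h.1
  · by_cases ht : j = 2 * n - 1
    · subst ht; exact htop _
    · exact links' j (by omega) (by omega)

/-- Gadget for the Horn clause `x₁ ∧ ⋯ ∧ xₙ → x_{n+1}` (1-based indices of the paper
translated to 0-based indices): `Ξ ∪ δ` is ∧-closed, `Ξ` projects to the first `n+1`
coordinates onto `ρ = {x : x₁ ∧ ⋯ ∧ xₙ ≤ x_{n+1}}`, and `δ` (the single tuple with `0`
in coordinate `n+1` and `1` elsewhere) projects onto its complement. -/
theorem stmt15 (n : ℕ) (hn : 3 ≤ n)
    (Xi : Set (Fin (2 * n) → Bool))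
    (hXi : Xi = {x | x ⟨2 * n - 1, by omega⟩ = true ∧
        (x ⟨0, by omega⟩ && x ⟨1, by omega⟩) = x ⟨n + 1, by omega⟩ ∧
        (∀ i : ℕ, ∀ _h3 : 3 ≤ i, ∀ _hn : i ≤ n - 1,
          (x ⟨i - 1, by omega⟩ && x ⟨n + i - 2, by omega⟩) = x ⟨n + i - 1, by omega⟩) ∧
        (x ⟨n - 1, by omega⟩ && x ⟨2 * n - 2, by omega⟩) ≤ x ⟨n, by omega⟩})
    (δ : Set (Fin (2 * n) → Bool))
    (hδ : δ = {fun i : Fin (2 * n) => decide ((i : ℕ) ≠ n)})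
    (ρ : Set (Fin (n + 1) → Bool))
    (hρ : ρ = {x | (∀ i : Fin (n + 1), (i : ℕ) < n → x i = true) → x ⟨n, by omega⟩ = true}) :
    ConjClosed (Xi ∪ δ) ∧
    projFirst (by omega : n + 1 ≤ 2 * n) Xi = ρ ∧
    projFirst (by omega : n + 1 ≤ 2 * n) δ = ρᶜ := by
  subst hXi hδ hρ
  -- conjunction with the tuple of `δ` either stays in `Ξ` or gives that tuple back
  have mixed : ∀ x : Fin (2 * n) → Bool, x ⟨2 * n - 1, by omega⟩ = true →
      (x ⟨0, by omega⟩ && x ⟨1, by omega⟩) = x ⟨n + 1, by omega⟩ →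
      (∀ i : ℕ, ∀ _h3 : 3 ≤ i, ∀ _hn : i ≤ n - 1,
        (x ⟨i - 1, by omega⟩ && x ⟨n + i - 2, by omega⟩) = x ⟨n + i - 1, by omega⟩) →
      (fun i : Fin (2 * n) => x i && decide ((i : ℕ) ≠ n)) ∈
        ({x | x ⟨2 * n - 1, by omega⟩ = true ∧
          (x ⟨0, by omega⟩ && x ⟨1, by omega⟩) = x ⟨n + 1, by omega⟩ ∧
          (∀ i : ℕ, ∀ _h3 : 3 ≤ i, ∀ _hn : i ≤ n - 1,
            (x ⟨i - 1, by omega⟩ && x ⟨n + i - 2, by omega⟩) = x ⟨n + i - 1, by omega⟩) ∧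
          (x ⟨n - 1, by omega⟩ && x ⟨2 * n - 2, by omega⟩) ≤ x ⟨n, by omega⟩} ∪
        {fun i : Fin (2 * n) => decide ((i : ℕ) ≠ n)} : Set (Fin (2 * n) → Bool)) := by
    intro x htop hbase hstep
    by_cases hl : x ⟨n - 1, by omega⟩ = true ∧ x ⟨2 * n - 2, by omega⟩ = true
    · right
      funext j
      by_cases hj : (j : ℕ) = n
      · simp [hj]
      · simp [hj, chain_eq_true hn x (fun _ => htop) (fun _ _ _ => hbase)
          (fun i h3 hi _ _ _ => hstep i h3 hi) (fun _ => hl.1) (fun _ => hl.2) j hj]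
    · left
      have ne : ∀ m : ℕ, m ≠ n → decide (m ≠ n) = true := fun m h => decide_eq_true h
      refine ⟨?_, ?_, ?_, ?_⟩
      · simp only [ne (2 * n - 1) (by omega), htop, Bool.and_true]
      · simp only [ne 0 (by omega), ne 1 (by omega), ne (n + 1) (by omega), Bool.and_true, hbase]
      · intro i h3 hi
        simp only [ne (i - 1) (by omega), ne (n + i - 2) (by omega), ne (n + i - 1) (by omega),
          Bool.and_true]
        exact hstep i h3 hi
      · rw [Bool.le_iff_imp]
        intro h
        simp only [Bool.and_eq_true] at h
        exact absurd ⟨h.1.1, h.2.1⟩ hl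
  refine ⟨?_, ?_, ?_⟩
  · rintro x (⟨hx1, hx2, hx3, hx4⟩ | rfl) y (⟨hy1, hy2, hy3, hy4⟩ | rfl)
    · left
      refine ⟨by simp only [hx1, hy1, Bool.and_true], ?_, ?_, ?_⟩
      · simp only [← hx2, ← hy2]
        ac_rfl
      · intro i h3 hi
        simp only [← hx3 i h3 hi, ← hy3 i h3 hi]
        ac_rfl
      · rw [Bool.le_iff_imp, Bool.and_eq_true] at hx4 hy4 ⊢
        simp only [Bool.and_eq_true]
        exact fun h => ⟨hx4 ⟨h.1.1, h.2.1⟩, hy4 ⟨h.1.2, h.2.2⟩⟩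
    · exact mixed x hx1 hx2 hx3
    · simp only [Bool.and_comm (decide _)]
      exact mixed y hy1 hy2 hy3
    · right
      simp only [Bool.and_self, Set.mem_singleton_iff]
  · ext y
    constructor
    · rintro ⟨x, ⟨hx1, hx2, hx3, hx4⟩, hxy⟩ hy
      have low : ∀ m : ℕ, ∀ _ : m < n, x ⟨m, by omega⟩ = true := fun m hm =>
        (hxy ⟨m, by omega⟩).trans (hy ⟨m, by omega⟩ hm)
      have links : ∀ k : ℕ, ∀ hk : k ≤ n - 3, x ⟨n + 1 + k, by omega⟩ = true := by
        intro k
        induction k with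
        | zero =>
          intro _
          rw [low 0 (by omega), low 1 (by omega)] at hx2
          exact hx2.symm
        | succ k ih =>
          intro hk
          have h := hx3 (k + 3) (by omega) (by omega)
          have e : (⟨n + (k + 3) - 2, by omega⟩ : Fin (2 * n)) = ⟨n + 1 + k, by omega⟩ :=
            Fin.ext (by simp only; omega)
          have e' : (⟨n + (k + 3) - 1, by omega⟩ : Fin (2 * n)) = ⟨n + 1 + (k + 1), by omega⟩ :=
            Fin.ext (by simp only; omega)
          rw [e, e', ih (by omega), low _ (by omega)] at h
          exact h.symm
      have hlink := links (n - 3) le_rfl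
      have e : (⟨n + 1 + (n - 3), by omega⟩ : Fin (2 * n)) = ⟨2 * n - 2, by omega⟩ :=
        Fin.ext (by simp only; omega)
      rw [e] at hlink
      rw [Bool.le_iff_imp, Bool.and_eq_true] at hx4
      exact (hxy ⟨n, by omega⟩).symm.trans (hx4 ⟨low _ (by omega), hlink⟩)
    · intro hy
      -- coordinate `n + k` carries the conjunction of the first `k + 1` entries of `y`
      let x : Fin (2 * n) → Bool := fun j =>
        if h : (j : ℕ) < n + 1 then y ⟨j, h⟩ else
          decide ((j : ℕ) = 2 * n - 1 ∨
            ∀ i : Fin (n + 1), (i : ℕ) < (j : ℕ) + 1 - n → y i = true)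
      have x_low : ∀ m : ℕ, ∀ h : m < n + 1, x ⟨m, by omega⟩ = y ⟨m, h⟩ := fun m h => dif_pos h
      have x_link : ∀ m : ℕ, ∀ _ : n + 1 ≤ m, ∀ _ : m ≤ 2 * n - 2, (x ⟨m, by omega⟩ = true ↔
          ∀ i : Fin (n + 1), (i : ℕ) < m + 1 - n → y i = true) := by
        intro m h₁ h₂
        have hlt : ¬ m < n + 1 := by omega
        have hne : m ≠ 2 * n - 1 := by omega
        simp only [x, dif_neg hlt, hne, false_or, decide_eq_true_eq]
      refine ⟨x, ⟨?_, ?_, ?_, ?_⟩, fun i => x_low i i.2⟩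
      · have hlt : ¬ 2 * n - 1 < n + 1 := by omega
        simp only [x, dif_neg hlt, true_or, decide_true]
      · rw [Bool.eq_iff_iff, Bool.and_eq_true, x_link _ le_rfl (by omega), x_low 0 (by omega),
          x_low 1 (by omega)]
        constructor
        · rintro ⟨h0, h1⟩ ⟨i, hi⟩ hlt
          have : i = 0 ∨ i = 1 := by simp only at hlt; omega
          rcases this with rfl | rfl
          · exact h0
          · exact h1
        · exact fun h => ⟨h _ (by simp only; omega), h _ (by simp only; omega)⟩
      · intro i h3 hi
        rw [Bool.eq_iff_iff, Bool.and_eq_true, x_link (n + i - 2) (by omega) (by omega),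
          x_link (n + i - 1) (by omega) (by omega), x_low (i - 1) (by omega)]
        constructor
        · rintro ⟨h, h'⟩ ⟨j, hj⟩ hlt
          by_cases hji : j = i - 1
          · subst hji; exact h
          · exact h' _ (by simp only at hlt ⊢; omega)
        · exact fun h => ⟨h _ (by simp only; omega), fun j hj => h j (by omega)⟩
      · rw [Bool.le_iff_imp, Bool.and_eq_true, x_link (2 * n - 2) (by omega) le_rfl,
          x_low (n - 1) (by omega), x_low n (by omega)]
        rintro ⟨h, h'⟩
        refine hy ?_
        rintro ⟨j, hj⟩ hlt
        by_cases hjn : j = n - 1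
        · subst hjn; exact h
        · exact h' _ (by simp only at hlt ⊢; omega)
  · ext y
    simp only [projFirst, Set.mem_singleton_iff, exists_eq_left, Set.mem_ofPred_eq,
      Set.mem_compl_iff, Fin.val_castLE, Classical.not_imp, Bool.not_eq_true]
    constructor
    · intro h
      refine ⟨fun i hi => ?_, ?_⟩
      · rw [← h i]
        exact decide_eq_true hi.ne
      · rw [← h]
        simp
    · rintro ⟨h, h'⟩ ⟨i, hi⟩
      by_cases hin : i = n
      · subst hin
        simp [h']
      · rw [h _ (by simp only; omega)]
        exact decide_eq_true hin
end
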